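/- arXiv:1111.2865 — 5 statements merged into one kernel-verified Lean document; each statement's English description precedes it below -/
import Mathlib

section
/- Let X⁻ₐ, X⁺ₐ ∈ SU(2) for a ∈ {0,…,4}, and let hₐ ∈ SU(2) be arbitrary. Set X̃±ₐ := X±ₐ·hₐ. For a ≠ b let m_{ab} := vec((X⁻ₐ)⁻¹ X⁻_b (X⁺_b)⁻¹ X⁺ₐ) ∈ ℝ³, and for distinct a, b with complementary indices c < d < e let D_{ab} := det[m_{ac}, m_{ad}, m_{ae}] (the 3×3 determinant whose columns are these vectors). Then the quantity D_{ab} computed from the transformed elements X̃±ₐ equals D_{ab} computed from the original X±ₐ, for all distinct a, b; in particular the sign β_{ab} := −sgn(D_{ab}·D_{ba}) is invariant under these transformations. (This is the invariance, equation (38), used in the proof of SU(2) gauge invariance of the proper vertex.) -/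
open Matrix

/-- The Pauli matrices σ₁, σ₂, σ₃. -/
noncomputable def pauli : Fin 3 → Matrix (Fin 2) (Fin 2) ℂ
  | 0 => !![0, 1; 1, 0]
  | 1 => !![0, -Complex.I; Complex.I, 0]
  | 2 => !![1, 0; 0, -1]

/-- Membership in SU(2): 2×2 complex unitary matrices of determinant 1. -/
def IsSU2 (g : Matrix (Fin 2) (Fin 2) ℂ) : Prop :=
  g ∈ Matrix.unitaryGroup (Fin 2) ℂ ∧ g.det = 1

/-- For g = c·I + i(v·σ) ∈ SU(2), `vecSU2 g = v`.  (Since tr(σᵢ·g) = 2i·vᵢ, the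
real vector v is recovered as vᵢ = Im(tr(σᵢ·g))/2.) -/
noncomputable def vecSU2 (g : Matrix (Fin 2) (Fin 2) ℂ) : Fin 3 → ℝ :=
  fun i => ((pauli i * g).trace).im / 2

/-- m_{ab} := vec((X⁻ₐ)⁻¹ X⁻_b (X⁺_b)⁻¹ X⁺ₐ) ∈ ℝ³. -/
noncomputable def mVec (Xm Xp : Fin 5 → Matrix (Fin 2) (Fin 2) ℂ) (a b : Fin 5) :
    Fin 3 → ℝ :=
  vecSU2 ((Xm a)⁻¹ * Xm b * (Xp b)⁻¹ * Xp a)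

/-- D_{ab} := det[m_{ac}, m_{ad}, m_{ae}], the 3×3 determinant with these columns. -/
noncomputable def Ddet (Xm Xp : Fin 5 → Matrix (Fin 2) (Fin 2) ℂ)
    (a c d e : Fin 5) : ℝ :=
  (Matrix.of fun i j => ![mVec Xm Xp a c, mVec Xm Xp a d, mVec Xm Xp a e] j i).det


lemma IsSU2.star_eq {g : Matrix (Fin 2) (Fin 2) ℂ} (hg : IsSU2 g) : star g = adjugate g := by
  have h1 : star g * g = 1 := (Matrix.mem_unitaryGroup_iff').1 hg.1
  have h2 : g * adjugate g = 1 := by rw [Matrix.mul_adjugate, hg.2, one_smul]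
  calc star g = star g * (g * adjugate g) := by rw [h2, mul_one]
    _ = adjugate g := by rw [← mul_assoc, h1, one_mul]

lemma IsSU2.inv_eq {g : Matrix (Fin 2) (Fin 2) ℂ} (hg : IsSU2 g) : g⁻¹ = star g :=
  Matrix.inv_eq_left_inv ((Matrix.mem_unitaryGroup_iff').1 hg.1)

lemma IsSU2.mul {g k : Matrix (Fin 2) (Fin 2) ℂ} (hg : IsSU2 g) (hk : IsSU2 k) :
    IsSU2 (g * k) :=
  ⟨mul_mem hg.1 hk.1, by rw [Matrix.det_mul, hg.2, hk.2, one_mul]⟩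

lemma IsSU2.inv {g : Matrix (Fin 2) (Fin 2) ℂ} (hg : IsSU2 g) : IsSU2 g⁻¹ := by
  refine ⟨?_, ?_⟩
  · rw [hg.inv_eq]; exact Unitary.star_mem hg.1
  · rw [hg.inv_eq, hg.star_eq, Matrix.det_adjugate, hg.2, one_pow]

lemma IsSU2.exists_form {g : Matrix (Fin 2) (Fin 2) ℂ} (hg : IsSU2 g) :
    ∃ x y z w : ℝ, g = !![⟨x, y⟩, ⟨z, w⟩; ⟨-z, w⟩, ⟨x, -y⟩] := by
  have h := hg.star_eq
  have h00 := congrFun (congrFun h 0) 0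
  have h10 := congrFun (congrFun h 1) 0
  simp [Matrix.adjugate_fin_two, Matrix.star_apply] at h00 h10
  refine ⟨(g 0 0).re, (g 0 0).im, (g 0 1).re, (g 0 1).im, ?_⟩
  have e10 : g 1 0 = -(starRingEnd ℂ) (g 0 1) := by rw [h10]; ring
  ext i j
  fin_cases i <;> fin_cases j <;> apply Complex.ext <;> simp [← h00, e10]

/-- Traceless part. -/
noncomputable def tl (g : Matrix (Fin 2) (Fin 2) ℂ) : Matrix (Fin 2) (Fin 2) ℂ :=
  g - (g.trace / 2) • (1 : Matrix (Fin 2) (Fin 2) ℂ)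

lemma det_vec {g₁ g₂ g₃ : Matrix (Fin 2) (Fin 2) ℂ} (h₁ : IsSU2 g₁) (h₂ : IsSU2 g₂)
    (h₃ : IsSU2 g₃) :
    (Matrix.of fun i j => ![vecSU2 g₁, vecSU2 g₂, vecSU2 g₃] j i).det
      = (tl g₁ * tl g₂ * tl g₃).trace.re / 2 := by
  obtain ⟨x, y, z, w, rfl⟩ := h₁.exists_form
  obtain ⟨x', y', z', w', rfl⟩ := h₂.exists_form
  obtain ⟨x'', y'', z'', w'', rfl⟩ := h₃.exists_form
  simp [Matrix.det_fin_three, vecSU2, pauli, tl, Matrix.trace_fin_two, Matrix.mul_apply,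
    Fin.sum_univ_two, Matrix.one_apply]
  ring

lemma tl_conj {k : Matrix (Fin 2) (Fin 2) ℂ} (hk : IsSU2 k) (g : Matrix (Fin 2) (Fin 2) ℂ) :
    tl (k⁻¹ * g * k) = k⁻¹ * tl g * k := by
  have hu : IsUnit k.det := by rw [hk.2]; exact isUnit_one
  have ht : (k⁻¹ * g * k).trace = g.trace := by
    rw [Matrix.trace_mul_comm, ← mul_assoc, Matrix.mul_nonsing_inv k hu, one_mul]
  unfold tl
  rw [ht, mul_sub, sub_mul]
  simp [Matrix.nonsing_inv_mul k hu]

lemma trace_conj {k : Matrix (Fin 2) (Fin 2) ℂ} (hk : IsSU2 k)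
    (g₁ g₂ g₃ : Matrix (Fin 2) (Fin 2) ℂ) :
    ((k⁻¹ * g₁ * k) * (k⁻¹ * g₂ * k) * (k⁻¹ * g₃ * k)).trace = (g₁ * g₂ * g₃).trace := by
  have hu : IsUnit k.det := by rw [hk.2]; exact isUnit_one
  have e : (k⁻¹ * g₁ * k) * (k⁻¹ * g₂ * k) * (k⁻¹ * g₃ * k) = k⁻¹ * (g₁ * g₂ * g₃) * k := by
    calc _ = k⁻¹ * g₁ * (k * k⁻¹) * g₂ * (k * k⁻¹) * g₃ * k := by simp only [mul_assoc]
      _ = _ := by rw [Matrix.mul_nonsing_inv k hu]; simp only [mul_one, mul_assoc]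
  rw [e, Matrix.trace_mul_comm, ← mul_assoc, Matrix.mul_nonsing_inv k hu, one_mul]

lemma Ddet_inv (Xm Xp h : Fin 5 → Matrix (Fin 2) (Fin 2) ℂ)
    (hXm : ∀ a, IsSU2 (Xm a)) (hXp : ∀ a, IsSU2 (Xp a)) (hh : ∀ a, IsSU2 (h a))
    (a c d e : Fin 5) :
    Ddet (fun x => Xm x * h x) (fun x => Xp x * h x) a c d e = Ddet Xm Xp a c d e := by
  have hG : ∀ b, IsSU2 ((Xm a)⁻¹ * Xm b * (Xp b)⁻¹ * Xp a) := fun b =>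
    (((hXm a).inv.mul (hXm b)).mul (hXp b).inv).mul (hXp a)
  have hc : ∀ b, (Xm a * h a)⁻¹ * (Xm b * h b) * (Xp b * h b)⁻¹ * (Xp a * h a)
      = (h a)⁻¹ * ((Xm a)⁻¹ * Xm b * (Xp b)⁻¹ * Xp a) * h a := by
    intro b
    have hu : IsUnit (h b).det := by rw [(hh b).2]; exact isUnit_one
    rw [Matrix.mul_inv_rev, Matrix.mul_inv_rev]
    calc _ = (h a)⁻¹ * (Xm a)⁻¹ * Xm b * (h b * (h b)⁻¹) * (Xp b)⁻¹ * Xp a * h a := by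
          simp only [mul_assoc]
      _ = _ := by rw [Matrix.mul_nonsing_inv _ hu]; simp only [mul_one, mul_assoc]
  have hG' : ∀ b, IsSU2 ((h a)⁻¹ * ((Xm a)⁻¹ * Xm b * (Xp b)⁻¹ * Xp a) * h a) := fun b =>
    ((hh a).inv.mul (hG b)).mul (hh a)
  unfold Ddet mVec
  simp only [hc]
  rw [det_vec (hG' c) (hG' d) (hG' e), det_vec (hG c) (hG d) (hG e),
    tl_conj (hh a), tl_conj (hh a), tl_conj (hh a), trace_conj (hh a)]

/-- The quantities D_{ab} (and hence the signs β_{ab} = −sgn(D_{ab}·D_{ba})) are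
invariant under the transformations X±ₐ ↦ X±ₐ·hₐ with hₐ ∈ SU(2). -/
theorem Ddet_gauge_invariant (Xm Xp h : Fin 5 → Matrix (Fin 2) (Fin 2) ℂ)
    (hXm : ∀ a, IsSU2 (Xm a)) (hXp : ∀ a, IsSU2 (Xp a)) (hh : ∀ a, IsSU2 (h a)) :
    ∀ a b c d e : Fin 5, a ≠ b → c < d → d < e →
      ({a, b, c, d, e} : Finset (Fin 5)) = Finset.univ →
      Ddet (fun x => Xm x * h x) (fun x => Xp x * h x) a c d e = Ddet Xm Xp a c d e ∧
      -Real.sign (Ddet (fun x => Xm x * h x) (fun x => Xp x * h x) a c d e *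
          Ddet (fun x => Xm x * h x) (fun x => Xp x * h x) b c d e)
        = -Real.sign (Ddet Xm Xp a c d e * Ddet Xm Xp b c d e) := by
  intro a b c d e _ _ _ _
  simp only [Ddet_inv Xm Xp h hXm hXp hh, and_self]
end

section
/- Let p₀,…,p₄ ∈ ℝ⁴ be affinely independent (a geometric 4-simplex), with outward unit facet normals N₀,…,N₄. Fix a ∈ {0,…,4} and let R be a 4×4 real matrix with RᵀR = I₄ and det R = 1. Suppose that for every b ≠ a there exist a nonzero real number λ_b and a unit vector v_b ∈ ℝ⁴ with ⟨v_b, e₀⟩ = 0 such that Nₐ ∧ N_b = λ_b·((R·e₀) ∧ (R·v_b)). Then Nₐ = R·e₀ or Nₐ = −(R·e₀). (This is Lemma 2.1 of the paper, stating that the reconstructed simplex normals coincide, up to sign, with the images of the fixed internal vector under the parallel transports.) -/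
open Matrix

/-- The antisymmetric 4×4 matrix (u ∧ v)_{IJ} = u_I v_J − u_J v_I. -/
def wedge (u v : Fin 4 → ℝ) : Matrix (Fin 4) (Fin 4) ℝ :=
  Matrix.of fun I J => u I * v J - u J * v I

/-- e₀ := (1,0,0,0) ∈ ℝ⁴. -/
def e0 : Fin 4 → ℝ := ![1, 0, 0, 0]

/-- N is the outward unit normal to the a-th facet of the 4-simplex with vertices p:
it is a unit vector orthogonal to p_b − p_c for all b, c ≠ a, with ⟨N, pₐ − p_b⟩ < 0
for all b ≠ a. -/
def IsOutwardNormal (p : Fin 5 → Fin 4 → ℝ) (a : Fin 5) (N : Fin 4 → ℝ) : Prop :=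
  N ⬝ᵥ N = 1 ∧ (∀ b c : Fin 5, b ≠ a → c ≠ a → N ⬝ᵥ (p b - p c) = 0) ∧
    ∀ b : Fin 5, b ≠ a → N ⬝ᵥ (p a - p b) < 0

/-- Contracting the wedge identity with `w` puts `r` in the span of `n` and `m`. -/
lemma wedge_contract (n m r w : Fin 4 → ℝ) (lam : ℝ) (hl : lam ≠ 0)
    (hw : w ⬝ᵥ w = 1) (hrw : w ⬝ᵥ r = 0)
    (h : wedge n m = lam • wedge r w) :
    ∃ x y : ℝ, r = x • n + y • m := by
  refine ⟨(m ⬝ᵥ w) / lam, -(n ⬝ᵥ w) / lam, ?_⟩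
  funext i
  have hij : ∀ j, n i * m j - n j * m i = lam * (r i * w j - r j * w i) := by
    intro j
    have := congrFun (congrFun h i) j
    simpa [wedge] using this
  have h0 := hij 0
  have h1 := hij 1
  have h2 := hij 2
  have h3 := hij 3
  simp only [dotProduct, Fin.sum_univ_four] at hw hrw
  simp only [Pi.add_apply, Pi.smul_apply, smul_eq_mul, dotProduct, Fin.sum_univ_four]
  field_simp
  linear_combination -(w 0) * h0 - w 1 * h1 - w 2 * h2 - w 3 * h3 - lam * r i * hw
    + lam * w i * hrw

/-- If each bivector Nₐ ∧ N_b (b ≠ a) is a nonzero multiple of (R·e₀) ∧ (R·v_b) with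
v_b a unit vector orthogonal to e₀, then Nₐ = ±R·e₀  (Lemma 2.1 of the paper). -/
theorem normal_is_pm_rotated_e0 (p : Fin 5 → Fin 4 → ℝ) (hp : AffineIndependent ℝ p)
    (N : Fin 5 → Fin 4 → ℝ) (hN : ∀ a, IsOutwardNormal p a (N a))
    (a : Fin 5) (R : Matrix (Fin 4) (Fin 4) ℝ) (hR : Rᵀ * R = 1) (hdet : R.det = 1)
    (hwedge : ∀ b : Fin 5, b ≠ a → ∃ lam : ℝ, lam ≠ 0 ∧ ∃ v : Fin 4 → ℝ,
      v ⬝ᵥ v = 1 ∧ v ⬝ᵥ e0 = 0 ∧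
      wedge (N a) (N b) = lam • wedge (R.mulVec e0) (R.mulVec v)) :
    N a = R.mulVec e0 ∨ N a = -(R.mulVec e0) := by
  obtain ⟨b, c, d, hba, hca, hda, hbc, hbd, hcd⟩ : ∃ b c d : Fin 5,
      b ≠ a ∧ c ≠ a ∧ d ≠ a ∧ b ≠ c ∧ b ≠ d ∧ c ≠ d := by
    clear hwedge
    revert a
    decide
  have hdot : ∀ u v : Fin 4 → ℝ, R.mulVec u ⬝ᵥ R.mulVec v = u ⬝ᵥ v := by
    intro u v
    rw [Matrix.dotProduct_mulVec, Matrix.vecMul_mulVec, ← Matrix.dotProduct_mulVec]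
    simp [hR]
  have hspan : ∀ b : Fin 5, b ≠ a → ∃ x y : ℝ, R.mulVec e0 = x • N a + y • N b := by
    intro b hb
    obtain ⟨lam, hl, v, hv, hve, h⟩ := hwedge b hb
    exact wedge_contract _ _ _ (R.mulVec v) lam hl (by rw [hdot, hv]) (by rw [hdot, hve]) h
  have hr : R.mulVec e0 ⬝ᵥ R.mulVec e0 = 1 := by
    rw [hdot]
    simp [e0, dotProduct, Fin.sum_univ_four]
  obtain ⟨x, y, hxy⟩ := hspan b hba
  obtain ⟨x', y', hxy'⟩ := hspan c hca
  have e1 := congrArg (fun z => z ⬝ᵥ (p b - p d)) hxy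
  have e2 := congrArg (fun z => z ⬝ᵥ (p b - p d)) hxy'
  have ha := (hN a).2.1 b d hba hda
  have hc := (hN c).2.1 b d hbc hcd.symm
  have hb := (hN b).2.2 d hbd.symm
  simp only [add_dotProduct, smul_dotProduct, ha, hc, smul_eq_mul] at e1 e2
  have hy : y = 0 := by
    have : y * (N b ⬝ᵥ (p b - p d)) = 0 := by linarith
    exact (mul_eq_zero.mp this).resolve_right hb.ne
  have hx : R.mulVec e0 = x • N a := by simpa [hy] using hxy
  have hx2 : x * x = 1 := by
    rw [hx] at hr
    simpa [(hN a).1] using hr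
  rcases mul_self_eq_one_iff.mp hx2 with h | h
  · left
    simp [hx, h]
  · right
    simp [hx, h]
end

section
/- Let Rₐ and R_b be 4×4 real orthogonal matrices, let αₐ, α_b ∈ {−1, 1}, and set Nₐ := αₐ·(Rₐ·e₀), N_b := α_b·(R_b·e₀). Let n̂ ∈ ℝ⁴ be a unit vector with ⟨n̂, e₀⟩ = 0, and let A > 0. Then (1/2)·Σ_{I,J} (Nₐ ∧ N_b)_{IJ} · (A·Rₐ·(e₀ ∧ n̂)·Rₐᵀ)_{IJ} = A·αₐ·α_b·⟨Rₐ⁻¹R_b·e₀, n̂⟩. (This is the bivector-pairing computation at the heart of Lemma 2.2 of the paper, relating the sign μ to the proper-orientation inequality.) -/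
open Matrix

theorem wedge_conj (R : Matrix (Fin 4) (Fin 4) ℝ) (u v : Fin 4 → ℝ) :
    R * wedge u v * Rᵀ = wedge (R.mulVec u) (R.mulVec v) := by
  have h : ∀ a b : Fin 4 → ℝ, wedge a b = vecMulVec a b - vecMulVec b a := by
    intro a b
    ext I J
    simp [wedge, vecMulVec_apply, mul_comm]
  rw [h, h, Matrix.mul_sub, Matrix.sub_mul, mul_vecMulVec, mul_vecMulVec, vecMulVec_mul,
    vecMulVec_mul, vecMul_transpose, vecMul_transpose]

theorem wedge_pair (u v x y : Fin 4 → ℝ) :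
    ∑ I : Fin 4, ∑ J : Fin 4, wedge u v I J * wedge x y I J
      = 2 * ((u ⬝ᵥ x) * (v ⬝ᵥ y) - (u ⬝ᵥ y) * (v ⬝ᵥ x)) := by
  simp only [wedge, Matrix.of_apply, dotProduct, Fin.sum_univ_four]
  ring

theorem orth_dot (R : Matrix (Fin 4) (Fin 4) ℝ) (h : Rᵀ * R = 1) (u v : Fin 4 → ℝ) :
    R.mulVec u ⬝ᵥ R.mulVec v = u ⬝ᵥ v := by
  rw [dotProduct_mulVec, ← mulVec_transpose, mulVec_mulVec, h, one_mulVec]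

/-- The bivector pairing computation of Lemma 2.2 of the paper: with Nₐ = αₐ·Rₐ·e₀ and
N_b = α_b·R_b·e₀ for orthogonal Rₐ, R_b and signs αₐ, α_b, and n̂ a unit vector
orthogonal to e₀, A > 0, one has
(1/2)·Σ_{I,J} (Nₐ ∧ N_b)_{IJ}·(A·Rₐ·(e₀ ∧ n̂)·Rₐᵀ)_{IJ} = A·αₐ·α_b·⟨Rₐ⁻¹R_b·e₀, n̂⟩. -/
theorem bivector_pairing (Ra Rb : Matrix (Fin 4) (Fin 4) ℝ)
    (hRa : Raᵀ * Ra = 1) (hRb : Rbᵀ * Rb = 1)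
    (αa αb : ℝ) (hαa : αa = 1 ∨ αa = -1) (hαb : αb = 1 ∨ αb = -1)
    (n : Fin 4 → ℝ) (hn : n ⬝ᵥ n = 1) (hn0 : n ⬝ᵥ e0 = 0)
    (A : ℝ) (hA : 0 < A) :
    (1 / 2) * ∑ I : Fin 4, ∑ J : Fin 4,
        (wedge (αa • Ra.mulVec e0) (αb • Rb.mulVec e0)) I J *
        (A • (Ra * wedge e0 n * Raᵀ)) I J
      = A * αa * αb * ((Ra⁻¹ * Rb).mulVec e0 ⬝ᵥ n) := by
  have hinv : Ra⁻¹ = Raᵀ := Matrix.inv_eq_left_inv hRa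
  have he : e0 ⬝ᵥ e0 = 1 := by simp [e0, dotProduct, Fin.sum_univ_four]
  have hrhs : (Ra⁻¹ * Rb).mulVec e0 ⬝ᵥ n = Rb.mulVec e0 ⬝ᵥ Ra.mulVec n := by
    rw [hinv, ← mulVec_mulVec, mulVec_transpose, ← dotProduct_mulVec]
  rw [hrhs, wedge_conj]
  have hs : ∀ I J, (A • wedge (Ra.mulVec e0) (Ra.mulVec n)) I J
      = wedge (A • Ra.mulVec e0) (Ra.mulVec n) I J := by
    intro I J
    simp [wedge]
    ring
  simp only [hs]
  rw [wedge_pair]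
  simp only [smul_dotProduct, dotProduct_smul, smul_eq_mul, orth_dot Ra hRa, he,
    dotProduct_comm e0 n, hn0]
  ring
end

section
/- Let p₀,…,p₄ ∈ ℝ⁴ be affinely independent (a geometric 4-simplex), with outward unit facet normals N₀,…,N₄. Then for any distinct a, b ∈ {0,…,4} with complementary indices {c, d, e}, the 4×4 determinant det[Nₐ, N_c, N_d, N_e] (with the indicated vectors as columns) is nonzero, and det[Nₐ, N_c, N_d, N_e] · det[N_b, N_c, N_d, N_e] < 0. (This is the key sign inequality established in the proof of Theorem 2.2 of the paper.) -/
open Matrix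

/-- det[N_x, N_c, N_d, N_e]: the 4×4 determinant with the indicated vectors as columns. -/
def det4 (N : Fin 5 → Fin 4 → ℝ) (x c d e : Fin 5) : ℝ :=
  (Matrix.of fun I J => ![N x, N c, N d, N e] J I).det

/-- If the Gram-type matrix of `v` against `w` is upper triangular, its diagonal product
is the product of the determinants. -/
theorem det_mul_det_of_tri (v w : Fin 4 → Fin 4 → ℝ)
    (h : ∀ i j : Fin 4, j < i → v i ⬝ᵥ w j = 0) :
    (Matrix.of fun I J => v J I).det * (Matrix.of w).det = ∏ i, v i ⬝ᵥ w i := by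
  have h1 : (Matrix.of fun I J => v J I).det = (Matrix.of v).det := by
    rw [← Matrix.det_transpose (Matrix.of v)]
    rfl
  have h2 : (Matrix.of v * (Matrix.of w)ᵀ).det = ∏ i, (Matrix.of v * (Matrix.of w)ᵀ) i i :=
    Matrix.det_of_upperTriangular (fun i j hij => h i j hij)
  rw [h1, ← Matrix.det_transpose (Matrix.of w), ← Matrix.det_mul, h2]
  rfl

/-- The key sign inequality in the proof of Theorem 2.2 of the paper: for any distinct
a, b with complementary indices {c, d, e}, det[Nₐ, N_c, N_d, N_e] ≠ 0 and
det[Nₐ, N_c, N_d, N_e]·det[N_b, N_c, N_d, N_e] < 0. -/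
theorem normals_det_sign (p : Fin 5 → Fin 4 → ℝ) (hp : AffineIndependent ℝ p)
    (N : Fin 5 → Fin 4 → ℝ) (hN : ∀ a, IsOutwardNormal p a (N a))
    (a b c d e : Fin 5) (hab : a ≠ b)
    (hcompl : ({a, b, c, d, e} : Finset (Fin 5)) = Finset.univ) :
    det4 N a c d e ≠ 0 ∧ det4 N a c d e * det4 N b c d e < 0 := by
  have hsurj : Function.Surjective ![a, b, c, d, e] := by
    intro x
    have hx : x ∈ ({a, b, c, d, e} : Finset (Fin 5)) := by rw [hcompl]; simp
    simp only [Finset.mem_insert, Finset.mem_singleton] at hx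
    rcases hx with h | h | h | h | h
    · exact ⟨0, h.symm⟩
    · exact ⟨1, h.symm⟩
    · exact ⟨2, h.symm⟩
    · exact ⟨3, h.symm⟩
    · exact ⟨4, h.symm⟩
  have hinj : Function.Injective ![a, b, c, d, e] := Finite.injective_iff_surjective.mpr hsurj
  have hac : a ≠ c := fun h => absurd (@hinj 0 2 h) (by decide)
  have had : a ≠ d := fun h => absurd (@hinj 0 3 h) (by decide)
  have hae : a ≠ e := fun h => absurd (@hinj 0 4 h) (by decide)
  have hbc : b ≠ c := fun h => absurd (@hinj 1 2 h) (by decide)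
  have hbd : b ≠ d := fun h => absurd (@hinj 1 3 h) (by decide)
  have hbe : b ≠ e := fun h => absurd (@hinj 1 4 h) (by decide)
  have hcd : c ≠ d := fun h => absurd (@hinj 2 3 h) (by decide)
  have hce : c ≠ e := fun h => absurd (@hinj 2 4 h) (by decide)
  have hde : d ≠ e := fun h => absurd (@hinj 3 4 h) (by decide)
  have hz : ∀ x y, y ≠ x → b ≠ x → N x ⬝ᵥ (p y - p b) = 0 :=
    fun x y hy hb => (hN x).2.1 y b hy hb
  have hneg : ∀ x, b ≠ x → N x ⬝ᵥ (p x - p b) < 0 := fun x hb => (hN x).2.2 b hb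
  have hpos : 0 < N b ⬝ᵥ (p a - p b) := by
    have h := (hN b).2.2 a hab
    rw [← neg_sub, dotProduct_neg] at h
    linarith
  have e1 := det_mul_det_of_tri ![N a, N c, N d, N e]
    ![p a - p b, p c - p b, p d - p b, p e - p b] (by
      intro i j hij
      fin_cases i <;> fin_cases j <;> first | (exact absurd hij (by decide)) | skip
      · exact hz c a hac hbc
      · exact hz d a had hbd
      · exact hz d c hcd hbd
      · exact hz e a hae hbe
      · exact hz e c hce hbe
      · exact hz e d hde hbe)
  have e2 := det_mul_det_of_tri ![N b, N c, N d, N e]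
    ![p a - p b, p c - p b, p d - p b, p e - p b] (by
      intro i j hij
      fin_cases i <;> fin_cases j <;> first | (exact absurd hij (by decide)) | skip
      · exact hz c a hac hbc
      · exact hz d a had hbd
      · exact hz d c hcd hbd
      · exact hz e a hae hbe
      · exact hz e c hce hbe
      · exact hz e d hde hbe)
  rw [Fin.prod_univ_four] at e1 e2
  change det4 N a c d e * _ = N a ⬝ᵥ (p a - p b) * N c ⬝ᵥ (p c - p b) * N d ⬝ᵥ (p d - p b)
    * N e ⬝ᵥ (p e - p b) at e1
  change det4 N b c d e * _ = N b ⬝ᵥ (p a - p b) * N c ⬝ᵥ (p c - p b) * N d ⬝ᵥ (p d - p b)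
    * N e ⬝ᵥ (p e - p b) at e2
  have ha := hneg a hab.symm
  have hcd' := mul_pos_of_neg_of_neg (hneg c hbc) (hneg d hbd)
  have he := hneg e hbe
  generalize (Matrix.of ![p a - p b, p c - p b, p d - p b, p e - p b]).det = D at e1 e2
  have f1 : 0 < det4 N a c d e * D := by
    rw [e1, mul_assoc (N a ⬝ᵥ (p a - p b))]
    exact mul_pos_of_neg_of_neg (mul_neg_of_neg_of_pos ha hcd') he
  have f2 : det4 N b c d e * D < 0 := by
    rw [e2, mul_assoc (N b ⬝ᵥ (p a - p b))]
    exact mul_neg_of_pos_of_neg (mul_pos hpos hcd') he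
  refine ⟨fun h => by simp [h] at f1, ?_⟩
  have f3 := mul_neg_of_pos_of_neg f1 f2
  by_contra hcon
  push Not at hcon
  nlinarith [mul_nonneg hcon (mul_self_nonneg D)]
end

section
/- Four-dimensional closure: let p₀,…,p₄ ∈ ℝ⁴ be affinely independent (a geometric 4-simplex). For each a ∈ {0,…,4}, let Vₐ be the 3-dimensional Hausdorff measure of the a-th facet (the convex hull of {p_b : b ≠ a}) and let Nₐ be its outward unit normal. Then Σ_{a=0}^{4} Vₐ·Nₐ = 0. (This is the theorem of Appendix B of the paper.) -/
open MeasureTheory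
open scoped RealInnerProductSpace

/-- A square matrix whose last column vanishes off the diagonal. -/
lemma closure_det_last (K : Matrix (Fin 4) (Fin 4) ℝ) (h : ∀ i : Fin 3, K i.castSucc 3 = 0) :
    K.det = K 3 3 * (K.submatrix (Fin.castSucc : Fin 3 → Fin 4) Fin.castSucc).det := by
  have h3 : (Fin.last 3 : Fin 4) = 3 := rfl
  rw [Matrix.det_succ_column K (Fin.last 3), Fin.sum_univ_castSucc, Finset.sum_eq_zero]
  · rw [Fin.succAbove_last, zero_add, h3]
    norm_num
  · intro i _
    rw [h3, h i]
    simp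

/-- The difference determinant as a bordered determinant. -/
lemma closure_det_border (p : Fin 5 → Fin 4 → ℝ) :
    (Matrix.of fun i : Fin 5 => (Fin.cons 1 (p i) : Fin 5 → ℝ)).det =
      (Matrix.of fun (i : Fin 4) (j : Fin 4) => p i.succ j - p 0 j).det := by
  have h1 : (Matrix.of fun i : Fin 5 => (Fin.cons 1 (p i) : Fin 5 → ℝ)).det =
      (Matrix.of fun i : Fin 5 => (Fin.cons (if i = 0 then 1 else 0)
        (fun j => if i = 0 then p i j else p i j - p 0 j) : Fin 5 → ℝ)).det := by
    refine Matrix.det_eq_of_forall_row_eq_smul_add_const (fun i => if i = 0 then 0 else 1) 0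
      (by simp) ?_
    intro i j
    refine Fin.cases ?_ (fun j => ?_) j <;> by_cases hi : i = 0 <;> simp [hi]
  rw [h1, Matrix.det_succ_column_zero, Finset.sum_eq_single 0]
  · simp
    congr 1
  · intro i _ hi
    simp [hi]
  · simp

lemma closure_det_perm (p : Fin 5 → Fin 4 → ℝ) (σ : Equiv.Perm (Fin 5)) :
    |(Matrix.of fun (i : Fin 4) (j : Fin 4) => p (σ i.succ) j - p (σ 0) j).det| =
      |(Matrix.of fun (i : Fin 4) (j : Fin 4) => p i.succ j - p 0 j).det| := by
  rw [← closure_det_border p, ← closure_det_border (fun i => p (σ i))]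
  have := Matrix.det_permute σ (Matrix.of fun i : Fin 5 => (Fin.cons 1 (p i) : Fin 5 → ℝ))
  have e : (Matrix.of fun i : Fin 5 => (Fin.cons 1 (p (σ i)) : Fin 5 → ℝ)) =
    (Matrix.of fun i : Fin 5 => (Fin.cons 1 (p i) : Fin 5 → ℝ)).submatrix σ id := rfl
  rw [e, this, abs_mul]
  rcases Int.units_eq_one_or (Equiv.Perm.sign σ) with h | h <;> simp [h]

/-- The linear map sending the standard basis to `v`. -/
noncomputable def closureMap (v : Fin 3 → EuclideanSpace ℝ (Fin 4)) :
    EuclideanSpace ℝ (Fin 3) →ₗ[ℝ] EuclideanSpace ℝ (Fin 4) :=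
  (EuclideanSpace.basisFun (Fin 3) ℝ).toBasis.constr ℝ v

lemma closureMap_basis (v : Fin 3 → EuclideanSpace ℝ (Fin 4)) (i : Fin 3) :
    closureMap v (EuclideanSpace.basisFun (Fin 3) ℝ i) = v i := by
  have := (EuclideanSpace.basisFun (Fin 3) ℝ).toBasis.constr_basis ℝ v i
  rwa [OrthonormalBasis.coe_toBasis] at this

/-- Base volume times height is the determinant. -/
lemma closure_normDet (v : Fin 3 → EuclideanSpace ℝ (Fin 4)) (hv : LinearIndependent ℝ v)
    (w n : EuclideanSpace ℝ (Fin 4)) (hn : ‖n‖ = 1) (hvn : ∀ i, ⟪v i, n⟫ = 0) :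
    (closureMap v).normDet * |⟪w, n⟫| =
      |(Matrix.of fun (i j : Fin 4) => (Fin.snoc v w : Fin 4 → EuclideanSpace ℝ (Fin 4)) i j).det| := by
  set A : Matrix (Fin 4) (Fin 4) ℝ :=
    Matrix.of fun (i j : Fin 4) => (Fin.snoc v w : Fin 4 → EuclideanSpace ℝ (Fin 4)) i j with hA
  set B : Matrix (Fin 4) (Fin 4) ℝ :=
    Matrix.of fun (i j : Fin 4) => (Fin.snoc v n : Fin 4 → EuclideanSpace ℝ (Fin 4)) i j with hB
  have key : ∀ x : EuclideanSpace ℝ (Fin 4),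
      (Matrix.of fun (i j : Fin 4) => (Fin.snoc v x : Fin 4 → EuclideanSpace ℝ (Fin 4)) i j).det
        * B.det = ⟪x, n⟫ * (Matrix.gram ℝ v).det := by
    intro x
    have h3 : (3 : Fin 4) = Fin.last 3 := rfl
    have ent : ∀ i j, ((Matrix.of fun (i j : Fin 4) =>
        (Fin.snoc v x : Fin 4 → EuclideanSpace ℝ (Fin 4)) i j) * B.transpose) i j =
        ⟪(Fin.snoc v x : Fin 4 → EuclideanSpace ℝ (Fin 4)) i,
          (Fin.snoc v n : Fin 4 → EuclideanSpace ℝ (Fin 4)) j⟫ := by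
      intro i j
      simp only [Matrix.mul_apply, Matrix.transpose_apply, hB, Matrix.of_apply, PiLp.inner_apply,
        RCLike.inner_apply, conj_trivial]
      exact Finset.sum_congr rfl fun k _ => mul_comm _ _
    rw [← Matrix.det_transpose B, ← Matrix.det_mul, closure_det_last]
    · rw [ent, h3, Fin.snoc_last, Fin.snoc_last]
      congr 2
      ext i j
      rw [Matrix.submatrix_apply, ent, Fin.snoc_castSucc, Fin.snoc_castSucc, Matrix.gram_apply]
    · intro i
      rw [ent, h3, Fin.snoc_last, Fin.snoc_castSucc, hvn]
  have hG : 0 < (Matrix.gram ℝ v).det := (Matrix.posDef_gram_of_linearIndependent hv).det_pos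
  have k1 := key w
  have k2 := key n
  rw [← hA] at k1
  rw [← hB, real_inner_self_eq_norm_sq, hn] at k2
  have k3 : (closureMap v).normDet ^ 2 = (Matrix.gram ℝ v).det := by
    have := (closureMap v).normDet_sq_eq_det_gram (EuclideanSpace.basisFun (Fin 3) ℝ)
    simp only [closureMap_basis] at this
    simpa using this
  rw [← sq_eq_sq₀ (mul_nonneg (closureMap v).normDet_nonneg (abs_nonneg _)) (abs_nonneg _),
    mul_pow, sq_abs, sq_abs, k3]
  apply mul_right_cancel₀ hG.ne'
  have : A.det ^ 2 * (Matrix.gram ℝ v).det = (A.det * B.det) ^ 2 := by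
    rw [mul_pow]; congr 1; linarith
  rw [this, k1]; ring

/-- The reference simplex. -/
noncomputable def closureRef : Set (EuclideanSpace ℝ (Fin 3)) :=
  convexHull ℝ (Set.range (Fin.cons 0 (EuclideanSpace.basisFun (Fin 3) ℝ) :
    Fin 4 → EuclideanSpace ℝ (Fin 3)))

lemma closure_volume (q : Fin 4 → EuclideanSpace ℝ (Fin 4)) :
    (μH[3] (convexHull ℝ (Set.range q))).toReal =
      (closureMap (fun i => q i.succ - q 0)).normDet * (μH[3] closureRef).toReal := by
  set f := closureMap (fun i => q i.succ - q 0) with hf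
  have h1 : convexHull ℝ (Set.range q) = (fun x => q 0 + x) '' (f '' closureRef) := by
    rw [closureRef, f.image_convexHull, ← Set.range_comp]
    have := (AffineEquiv.constVAdd ℝ (EuclideanSpace ℝ (Fin 4)) (q 0)).toAffineMap.image_convexHull
      (Set.range (f ∘ (Fin.cons 0 (EuclideanSpace.basisFun (Fin 3) ℝ) :
        Fin 4 → EuclideanSpace ℝ (Fin 3))))
    have e : ((AffineEquiv.constVAdd ℝ (EuclideanSpace ℝ (Fin 4)) (q 0)).toAffineMap :
      EuclideanSpace ℝ (Fin 4) → EuclideanSpace ℝ (Fin 4)) = fun x => q 0 + x := rfl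
    rw [e] at this
    rw [this, ← Set.range_comp]
    congr 2
    ext1 i
    refine Fin.cases ?_ (fun i => ?_) i
    · simp
    · simp only [Function.comp, Fin.cons_succ]
      rw [hf, closureMap_basis]; abel
  have h2 := f.hausdorffMeasure_image closureRef
  have h3 : ((Module.finrank ℝ (EuclideanSpace ℝ (Fin 3)) : ℕ) : ℝ) = 3 := by simp
  rw [h3] at h2
  rw [h1, (isometry_add_left (q 0)).hausdorffMeasure_image (Or.inl (by norm_num)), h2,
    ENNReal.toReal_mul, ENNReal.toReal_ofReal f.normDet_nonneg]

/-- Four-dimensional closure (Appendix B of the paper): for a geometric 4-simplex in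
Euclidean ℝ⁴ with facet volumes Vₐ (3-dimensional Hausdorff measures) and outward
unit facet normals Nₐ, one has Σₐ Vₐ·Nₐ = 0. -/
theorem four_dimensional_closure
    (p : Fin 5 → EuclideanSpace ℝ (Fin 4)) (hp : AffineIndependent ℝ p)
    (N : Fin 5 → EuclideanSpace ℝ (Fin 4))
    (hN : ∀ a : Fin 5, ‖N a‖ = 1 ∧
      (∀ b c : Fin 5, b ≠ a → c ≠ a → ⟪N a, p b - p c⟫ = 0) ∧
      ∀ b : Fin 5, b ≠ a → ⟪N a, p a - p b⟫ < 0) :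
    ∑ a : Fin 5,
        (μH[3] (convexHull ℝ (p '' {b : Fin 5 | b ≠ a}))).toReal • N a = 0 := by
  -- volume times height is a constant
  have hc : ∃ C : ℝ, ∀ a b : Fin 5, b ≠ a →
      (μH[3] (convexHull ℝ (p '' {b : Fin 5 | b ≠ a}))).toReal * ⟪N a, p a - p b⟫ = C := by
    refine ⟨-(|(Matrix.of fun (i : Fin 4) (j : Fin 4) => p i.succ j - p 0 j).det| *
      (μH[3] closureRef).toReal), fun a b hb => ?_⟩
    obtain ⟨hn, ho, hneg⟩ := hN a
    obtain ⟨σ, hσ4⟩ : ∃ σ : Equiv.Perm (Fin 5), σ 4 = a := ⟨Equiv.swap a 4, by simp⟩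
    have hne : ∀ i : Fin 4, σ i.castSucc ≠ a := by
      intro i h
      rw [← hσ4] at h
      have := σ.injective h
      exact absurd this (Fin.castSucc_lt_last i).ne
    have hset : p '' {b : Fin 5 | b ≠ a} = Set.range (fun i : Fin 4 => p (σ i.castSucc)) := by
      ext x
      constructor
      · rintro ⟨c, hc, rfl⟩
        have h4 : σ.symm c ≠ Fin.last 4 := by
          intro h
          apply hc
          rw [← hσ4]
          exact (σ.symm_apply_eq.1 h)
        refine ⟨(σ.symm c).castPred h4, ?_⟩
        simp
      · rintro ⟨i, rfl⟩
        exact ⟨_, hne i, rfl⟩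
    rw [hset, closure_volume]
    set v : Fin 3 → EuclideanSpace ℝ (Fin 4) :=
      fun i => p (σ i.succ.castSucc) - p (σ (0 : Fin 4).castSucc) with hv
    have hli : LinearIndependent ℝ v := by
      have h1 : AffineIndependent ℝ (fun i : Fin 4 => p (σ i.castSucc)) :=
        hp.comp_embedding (⟨fun i => σ i.castSucc, fun i j h =>
          Fin.castSucc_injective _ (σ.injective h)⟩ : Fin 4 ↪ Fin 5)
      have h2 := (affineIndependent_iff_linearIndependent_vsub ℝ _ (0 : Fin 4)).1 h1
      have h5 := h2.comp (fun i : Fin 3 => (⟨i.succ, Fin.succ_ne_zero i⟩ : {x : Fin 4 // x ≠ 0}))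
        (fun i j h => Fin.succ_injective _ (congrArg Subtype.val h))
      simp only [Function.comp_def, vsub_eq_sub] at h5
      exact h5
    have hvol := closure_normDet v hli (p a - p (σ 0)) (N a) hn (fun i => by
      rw [real_inner_comm]; exact ho _ _ (hne _) (hne _))
    have hdet := closure_det_perm (fun i j => p i j) σ
    have hm : (Matrix.of fun (i j : Fin 4) =>
        (Fin.snoc v (p a - p (σ 0)) : Fin 4 → EuclideanSpace ℝ (Fin 4)) i j) =
        (Matrix.of fun (i : Fin 4) (j : Fin 4) => p (σ i.succ) j - p (σ 0) j) := by
      ext i j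
      refine Fin.lastCases ?_ (fun i => ?_) i
      · have : (Fin.last 3).succ = (4 : Fin 5) := rfl
        simp only [Matrix.of_apply, Fin.snoc_last, this, hσ4]
        rfl
      · simp only [Matrix.of_apply, Fin.snoc_castSucc]
        rfl
    rw [hm, hdet] at hvol
    have hin : ⟪N a, p a - p b⟫ = ⟪N a, p a - p (σ 0)⟫ := by
      have := ho b (σ 0) hb (hne 0)
      have e : p a - p (σ 0) = (p a - p b) + (p b - p (σ 0)) := by abel
      rw [e, inner_add_right, this, add_zero]
    have hlt := hneg (σ 0) (hne 0)
    rw [hin]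
    rw [real_inner_comm, abs_of_neg hlt] at hvol
    rw [← hvol]
    ring
  obtain ⟨C, hC⟩ := hc
  set V : Fin 5 → ℝ := fun a => (μH[3] (convexHull ℝ (p '' {b : Fin 5 | b ≠ a}))).toReal with hV
  change ∑ a, V a • N a = 0
  have horth : ∀ b : Fin 5, ⟪∑ a, V a • N a, p b - p 0⟫ = 0 := by
    intro b
    by_cases hb : b = 0
    · simp [hb]
    rw [sum_inner, Finset.sum_eq_add_of_mem b 0 (Finset.mem_univ _) (Finset.mem_univ _) hb]
    · have e1 := hC b 0 (Ne.symm hb)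
      have e2 := hC 0 b hb
      rw [← neg_sub (p b) (p 0), inner_neg_right] at e2
      rw [real_inner_smul_left, real_inner_smul_left]
      change V b * _ = C at e1
      change V 0 * _ = C at e2
      linarith
    · rintro a _ ⟨h1, h2⟩
      rw [real_inner_smul_left, (hN a).2.1 b 0 (Ne.symm h1) (Ne.symm h2), mul_zero]
  have htop : vectorSpan ℝ (Set.range p) = ⊤ :=
    hp.vectorSpan_eq_top_of_card_eq_finrank_add_one (by simp)
  rw [vectorSpan_range_eq_span_range_vsub_right ℝ p 0] at htop
  set x := ∑ a, V a • N a with hx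
  have hall : ∀ y : EuclideanSpace ℝ (Fin 4), ⟪x, y⟫ = 0 := by
    intro y
    have hy : y ∈ Submodule.span ℝ (Set.range fun i : Fin 5 => p i -ᵥ p 0) := by
      rw [htop]; trivial
    induction hy using Submodule.span_induction with
    | mem z hz => obtain ⟨i, rfl⟩ := hz; exact horth i
    | zero => simp
    | add z w _ _ hz hw => rw [inner_add_right, hz, hw, add_zero]
    | smul c z _ hz => rw [real_inner_smul_right, hz, mul_zero]
  exact inner_self_eq_zero.1 (hall x)
end
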